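/- arXiv:1301.2147 — 2 statements merged into one kernel-verified Lean document; each statement's English description precedes it below -/
import Mathlib

section
/- Let n ≥ 1 and let A ∈ M_n(ℝ) be a matrix with no real eigenvalues (i.e., there is no λ ∈ ℝ and nonzero vector v ∈ ℝⁿ with Av = λv). Then there exists a matrix X ∈ M_n(ℝ) of rank two such that AX = XA. -/
open Matrix

/-- Left multiplication by a matrix with linearly independent columns preserves the rank. -/
lemma rank_mul_eq_right_of_linearIndependent_col {l m n K : Type*} [Fintype m] [Fintype n]
    [Field K] {P : Matrix l m K} (hP : LinearIndependent K P.col) (Q : Matrix m n K) :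
    (P * Q).rank = Q.rank := by
  rw [rank, rank, mulVecLin_mul, LinearMap.range_comp]
  exact (Submodule.equivMapOfInjective P.mulVecLin (mulVec_injective_iff.2 hP) _).finrank_eq.symm

/-- The real and imaginary parts of a complex eigenvector of a real matrix without real
eigenvectors are linearly independent. -/
lemma exists_linearIndependent_pair_of_isRoot_charpoly {n : Type*} [Fintype n] [DecidableEq n]
    (A : Matrix n n ℝ) (h : ¬∃ (μ : ℝ) (v : n → ℝ), v ≠ 0 ∧ A *ᵥ v = μ • v)
    {z : ℂ} (hz : (A.map (algebraMap ℝ ℂ)).charpoly.IsRoot z) :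
    ∃ a b : n → ℝ, LinearIndependent ℝ ![a, b] ∧
      A *ᵥ a = z.re • a - z.im • b ∧ A *ᵥ b = z.im • a + z.re • b := by
  rw [Polynomial.IsRoot, eval_charpoly, ← exists_mulVec_eq_zero_iff] at hz
  obtain ⟨v, hv, hzv⟩ := hz
  have hAv (i : n) : ∑ j, (A i j : ℂ) * v j = z * v i := by
    have := congrFun hzv i
    simp only [sub_mulVec, Pi.sub_apply, Pi.zero_apply, sub_eq_zero] at this
    simpa [mulVec, dotProduct, scalar_apply, diagonal_apply] using this.symm
  have ha : A *ᵥ (fun i => (v i).re) = z.re • (fun i => (v i).re) - z.im • fun i => (v i).im := by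
    ext i
    simpa [mulVec, dotProduct] using congrArg Complex.re (hAv i)
  have hb : A *ᵥ (fun i => (v i).im) = z.im • (fun i => (v i).re) + z.re • fun i => (v i).im := by
    ext i
    simpa [mulVec, dotProduct, add_comm] using congrArg Complex.im (hAv i)
  refine ⟨_, _, ?_, ha, hb⟩
  have h0 : (fun i => (v i).re) ≠ 0 ∨ (fun i => (v i).im) ≠ 0 := by
    by_contra! hc
    exact hv (funext fun i => Complex.ext (congrFun hc.1 i) (congrFun hc.2 i))
  generalize (fun i => (v i).re) = a at *
  generalize (fun i => (v i).im) = b at *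
  push Not at h
  by_cases hA : a = 0
  · subst hA
    refine absurd (hb.trans ?_) (h z.re b (by simpa using h0))
    simp
  · refine (LinearIndependent.pair_iff' hA).2 fun r hr => h (z.re - z.im * r) a hA ?_
    rw [ha, ← hr, sub_smul, mul_smul]

/-- The transpose of a matrix without eigenvectors has no eigenvectors. -/
lemma not_exists_transpose_mulVec_eq_smul {n K : Type*} [Fintype n] [Field K]
    {A : Matrix n n K} (h : ¬∃ (μ : K) (v : n → K), v ≠ 0 ∧ A *ᵥ v = μ • v) :
    ¬∃ (μ : K) (v : n → K), v ≠ 0 ∧ Aᵀ *ᵥ v = μ • v := by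
  classical
  have key (B : Matrix n n K) (μ : K) :
      (∃ v : n → K, v ≠ 0 ∧ B *ᵥ v = μ • v) ↔ (B - μ • 1).det = 0 := by
    simp [← exists_mulVec_eq_zero_iff, sub_mulVec, sub_eq_zero, smul_mulVec]
  simp only [key] at h ⊢
  rintro ⟨μ, hμ⟩
  refine h ⟨μ, ?_⟩
  rwa [← det_transpose, transpose_sub, transpose_smul, transpose_one]

/-- A real matrix with no real eigenvalue commutes with a rank-two matrix. -/
theorem commutes_with_rank_two_of_no_real_eigenvalue (n : ℕ) (hn : 1 ≤ n)
    (A : Matrix (Fin n) (Fin n) ℝ)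
    (h : ¬∃ (μ : ℝ) (v : Fin n → ℝ), v ≠ 0 ∧ A.mulVec v = μ • v) :
    ∃ X : Matrix (Fin n) (Fin n) ℝ, X.rank = 2 ∧ A * X = X * A := by
  obtain ⟨z, hz⟩ : ∃ z, (A.map (algebraMap ℝ ℂ)).charpoly.IsRoot z := by
    refine IsAlgClosed.exists_root _ ?_
    rw [charpoly_degree_eq_dim, Fintype.card_fin]
    exact_mod_cast (by lia : n ≠ 0)
  have hzt : (Aᵀ.map (algebraMap ℝ ℂ)).charpoly.IsRoot z := by
    rwa [transpose_map, charpoly_transpose]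
  obtain ⟨a, b, hab, ha, hb⟩ := exists_linearIndependent_pair_of_isRoot_charpoly A h hz
  obtain ⟨c, d, hcd, hc, hd⟩ := exists_linearIndependent_pair_of_isRoot_charpoly Aᵀ
    (not_exists_transpose_mulVec_eq_smul h) hzt
  rw [mulVec_transpose] at hc hd
  have hX : (of ![a, b])ᵀ * of ![c, -d] = vecMulVec a c - vecMulVec b d := by
    ext i j
    simp [mul_apply, vecMulVec_apply, sub_eq_add_neg]
  refine ⟨(of ![a, b])ᵀ * of ![c, -d], ?_, ?_⟩
  · have hcd' : LinearIndependent ℝ ![c, -d] := by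
      rw [LinearIndependent.pair_iff] at hcd ⊢
      intro s t hst
      simpa using hcd s (-t) (by simpa using hst)
    rw [rank_mul_eq_right_of_linearIndependent_col (P := (of ![a, b])ᵀ) hab]
    exact LinearIndependent.rank_matrix hcd'
  · rw [hX, mul_sub, sub_mul, mul_vecMulVec, mul_vecMulVec, vecMulVec_mul, vecMulVec_mul,
      ha, hb, hc, hd]
    ext i j
    simp only [vecMulVec_apply, Matrix.sub_apply, Pi.sub_apply, Pi.add_apply, Pi.smul_apply,
      smul_eq_mul]
    ring
end

section
/- Let A ∈ M_4(ℝ) be a matrix with no real eigenvalues which is not diagonalizable over ℂ (i.e., A, viewed as a complex matrix, is not similar over ℂ to any diagonal matrix). Then there exists a nonzero matrix N ∈ M_4(ℝ) with N² = 0 such that AN = NA. -/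
open Matrix

/-- An element of a finite-dimensional algebra whose minimal polynomial is not squarefree commutes
with a nonzero element of square zero. -/
theorem exists_sq_eq_zero_commute_of_not_squarefree_minpoly {K R : Type*} [Field K] [Ring R]
    [Algebra K R] [FiniteDimensional K R] {a : R} (ha : ¬Squarefree (minpoly K a)) :
    ∃ b : R, b ≠ 0 ∧ b ^ 2 = 0 ∧ a * b = b * a := by
  simp only [Squarefree, not_forall] at ha
  obtain ⟨p, ⟨q, hq⟩, hp⟩ := ha
  have hm : minpoly K a ≠ 0 := minpoly.ne_zero (.of_finite K a)
  refine ⟨Polynomial.aeval a (p * q), fun h0 ↦ hp ?_, ?_, ?_⟩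
  · have hdvd := minpoly.dvd K a h0
    rw [hq, mul_assoc] at hdvd
    have hpq : p * q ≠ 0 := fun h ↦ hm (by rw [hq, mul_assoc, h, mul_zero])
    exact isUnit_of_dvd_one ((mul_dvd_mul_iff_right hpq).mp (by rwa [one_mul]))
  · rw [← map_pow, show (p * q) ^ 2 = (p * p * q) * q by ring, ← hq, map_mul, minpoly.aeval,
      zero_mul]
  · exact (Polynomial.aeval_eq_sum_range (R := K) (p := p * q) a ▸
      Commute.sum_right _ _ _ fun i _ ↦ ((Commute.refl a).pow_right i).smul_right _)

/-- A square matrix over an algebraically closed field annihilated by a squarefree polynomial is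
similar to a diagonal matrix. -/
theorem Matrix.exists_eq_mul_diagonal_mul_inv_of_squarefree {K n : Type*} [Field K] [IsAlgClosed K]
    [Fintype n] [DecidableEq n] {A : Matrix n n K} {p : Polynomial K} (hp : Squarefree p)
    (hA : Polynomial.aeval A p = 0) :
    ∃ (P : (Matrix n n K)ˣ) (d : n → K),
      A = (P : Matrix n n K) * diagonal d * ((P⁻¹ : (Matrix n n K)ˣ) : Matrix n n K) := by
  have hss : Module.End.IsSemisimple (toLinAlgEquiv' A) :=
    Module.End.isSemisimple_of_squarefree_aeval_eq_zero hp <| by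
      rw [Polynomial.aeval_algHom_apply, hA, map_zero]
  let s : Set (n → K) := {v | ∃ μ : K, A *ᵥ v = μ • v}
  have hs : ⊤ ≤ Submodule.span K s := by
    rw [← hss.iSup_eigenspace_eq_top]
    refine iSup_le fun μ v hv ↦ Submodule.subset_span ⟨μ, ?_⟩
    simpa using Module.End.mem_eigenspace_iff.mp hv
  let b₀ := Module.Basis.ofSpan hs
  let b : Module.Basis n K (n → K) := b₀.reindex (b₀.indexEquiv (Pi.basisFun K n))
  have hb (i : n) : ∃ μ : K, A *ᵥ b i = μ • b i := by
    rw [Module.Basis.reindex_apply]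
    exact Module.Basis.ofSpan_subset hs ⟨_, rfl⟩
  choose d hd using hb
  let P : (Matrix n n K)ˣ :=
    ⟨(Pi.basisFun K n).toMatrix b, b.toMatrix (Pi.basisFun K n),
      Module.Basis.toMatrix_mul_toMatrix_flip _ _, Module.Basis.toMatrix_mul_toMatrix_flip _ _⟩
  refine ⟨P, d, (Units.eq_mul_inv_iff_mul_eq P).mpr ?_⟩
  ext i j
  rw [mul_diagonal, mul_comm]
  simpa [P, Module.Basis.toMatrix_apply, mul_apply, mulVec, dotProduct] using congrFun (hd j) i

/-- A `4 × 4` real matrix with no real eigenvalue which is not diagonalizable over `ℂ`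
commutes with a nonzero square-zero real matrix. -/
theorem commutes_with_sq_zero_of_not_diagonalizable (A : Matrix (Fin 4) (Fin 4) ℝ)
    (h : ¬∃ (μ : ℝ) (v : Fin 4 → ℝ), v ≠ 0 ∧ A.mulVec v = μ • v)
    (hdiag : ¬∃ (P : (Matrix (Fin 4) (Fin 4) ℂ)ˣ) (d : Fin 4 → ℂ),
      A.map (Complex.ofReal) = (P : Matrix (Fin 4) (Fin 4) ℂ) * Matrix.diagonal d *
        ((P⁻¹ : (Matrix (Fin 4) (Fin 4) ℂ)ˣ) : Matrix (Fin 4) (Fin 4) ℂ)) :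
    ∃ N : Matrix (Fin 4) (Fin 4) ℝ, N ≠ 0 ∧ N ^ 2 = 0 ∧ A * N = N * A := by
  refine exists_sq_eq_zero_commute_of_not_squarefree_minpoly (K := ℝ) fun hsq ↦ hdiag ?_
  refine exists_eq_mul_diagonal_mul_inv_of_squarefree
    (p := (minpoly ℝ A).map (algebraMap ℝ ℂ))
    (PerfectField.separable_iff_squarefree.mpr hsq).map.squarefree ?_
  rw [Polynomial.aeval_map_algebraMap]
  change Polynomial.aeval (Complex.ofRealAm.mapMatrix A) (minpoly ℝ A) = 0
  rw [Polynomial.aeval_algHom_apply, minpoly.aeval, map_zero]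
end
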